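/- Let n ≥ 1 and s ∈ (0, 1) with n > 2s, and let {f_k} be a sequence of Schwartz functions on ℝⁿ that is bounded in the fractional Sobolev norm, i.e. sup_k ∫_{ℝⁿ} (1 + |ξ|²)^s |f̂_k(ξ)|² dξ < ∞. Then for every exponent q with 1 ≤ q < 2n/(n − 2s) there exists a subsequence {f_{k_j}} and a function g ∈ L^q_loc(ℝⁿ) such that f_{k_j} → g strongly in L^q(K) for every compact set K ⊂ ℝⁿ. -/

import Mathlib

open MeasureTheory Real Filter
open scoped FourierTransform

namespace FractionalSobolev

open scoped SchwartzMap ENNReal Topology ContDiff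

variable {E : Type*} [NormedAddCommGroup E] [InnerProductSpace ℝ E] [FiniteDimensional ℝ E]
  [MeasurableSpace E] [BorelSpace E]

theorem integrable_weight_mul_norm_sq {s : ℝ} (hs1 : s ≤ 1) (f : 𝓢(E, ℂ)) :
    Integrable (fun ξ => (1 + ‖ξ‖ ^ 2) ^ s * ‖f ξ‖ ^ 2) := by
  obtain ⟨C₀, hC₀, h₀⟩ := f.decay 0 0
  obtain ⟨C₂, hC₂, h₂⟩ := f.decay 2 0
  simp only [norm_iteratedFDeriv_zero, pow_zero, one_mul] at h₀ h₂
  refine Integrable.mono' (f.integrable.norm.const_mul (C₀ + C₂)) ?_ (ae_of_all _ fun ξ => ?_)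
  · refine Continuous.aestronglyMeasurable ?_
    have := f.continuous
    refine Continuous.mul (Continuous.rpow_const (by fun_prop) fun x => Or.inl ?_) (by fun_prop)
    positivity
  · rw [Real.norm_of_nonneg (by positivity)]
    have h1 : (1 + ‖ξ‖ ^ 2) ^ s ≤ 1 + ‖ξ‖ ^ 2 := by
      conv_rhs => rw [← Real.rpow_one (1 + ‖ξ‖ ^ 2)]
      exact Real.rpow_le_rpow_of_exponent_le (by nlinarith [sq_nonneg ‖ξ‖]) hs1
    calc (1 + ‖ξ‖ ^ 2) ^ s * ‖f ξ‖ ^ 2 ≤ (1 + ‖ξ‖ ^ 2) * ‖f ξ‖ ^ 2 := by gcongr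
      _ = (‖f ξ‖ + ‖ξ‖ ^ 2 * ‖f ξ‖) * ‖f ξ‖ := by ring
      _ ≤ (C₀ + C₂) * ‖f ξ‖ := by gcongr <;> [exact h₀ ξ; exact h₂ ξ]

theorem fourier_schwartz_sub (f g : 𝓢(E, ℂ)) : 𝓕 (f - g) = 𝓕 f - 𝓕 g :=
  map_sub (FourierTransform.fourierCLE ℂ 𝓢(E, ℂ)) f g

/-- The squared `H^s` norm of a Schwartz function. -/
noncomputable def energy (s : ℝ) (f : 𝓢(E, ℂ)) : ℝ :=
  ∫ ξ, (1 + ‖ξ‖ ^ 2) ^ s * ‖𝓕 f ξ‖ ^ 2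

theorem energy_nonneg (s : ℝ) (f : 𝓢(E, ℂ)) : 0 ≤ energy s f :=
  integral_nonneg fun ξ => by positivity

theorem energy_sub_le {s : ℝ} (hs1 : s ≤ 1) (f g : 𝓢(E, ℂ)) :
    energy s (f - g) ≤ 2 * energy s f + 2 * energy s g := by
  unfold energy
  have hf := integrable_weight_mul_norm_sq hs1 (𝓕 f)
  have hg := integrable_weight_mul_norm_sq hs1 (𝓕 g)
  rw [← integral_const_mul, ← integral_const_mul,
    ← integral_add (hf.const_mul 2) (hg.const_mul 2)]
  refine integral_mono (integrable_weight_mul_norm_sq hs1 _)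
    ((hf.const_mul 2).add (hg.const_mul 2)) fun ξ => ?_
  have h1 : ‖𝓕 (f - g) ξ‖ ≤ ‖𝓕 f ξ‖ + ‖𝓕 g ξ‖ := by
    rw [fourier_schwartz_sub]
    exact norm_sub_le _ _
  have h2 : ‖𝓕 (f - g) ξ‖ ^ 2 ≤ 2 * ‖𝓕 f ξ‖ ^ 2 + 2 * ‖𝓕 g ξ‖ ^ 2 := by
    nlinarith [norm_nonneg (𝓕 (f - g) ξ), sq_nonneg (‖𝓕 f ξ‖ - ‖𝓕 g ξ‖)]
  have h3 : 0 ≤ (1 + ‖ξ‖ ^ 2) ^ s := by positivity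
  dsimp only
  nlinarith [mul_le_mul_of_nonneg_left h2 h3]

theorem integral_norm_sq_fourier_le_energy {s : ℝ} (hs0 : 0 ≤ s) (hs1 : s ≤ 1) (f : 𝓢(E, ℂ)) :
    ∫ ξ, ‖𝓕 f ξ‖ ^ 2 ≤ energy s f := by
  refine integral_mono (by simpa using integrable_weight_mul_norm_sq (s := 0) zero_le_one (𝓕 f))
    (integrable_weight_mul_norm_sq hs1 _) fun ξ => ?_
  have : 1 ≤ (1 + ‖ξ‖ ^ 2) ^ s := Real.one_le_rpow (by nlinarith [sq_nonneg ‖ξ‖]) hs0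
  exact le_mul_of_one_le_left (by positivity) this

/-- A smooth frequency cutoff at scale `R`. -/
structure IsCutoff (χ : E → ℂ) (R : ℝ) : Prop where
  hasCompactSupport : HasCompactSupport χ
  contDiff : ContDiff ℝ ∞ χ
  norm_le_one : ∀ ξ, ‖χ ξ‖ ≤ 1
  norm_one_sub_le_one : ∀ ξ, ‖1 - χ ξ‖ ≤ 1
  eq_one : ∀ ξ, ‖ξ‖ ≤ R → χ ξ = 1
  eq_zero : ∀ ξ, 2 * R ≤ ‖ξ‖ → χ ξ = 0

omit [FiniteDimensional ℝ E] [MeasurableSpace E] [BorelSpace E] in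
theorem IsCutoff.hasTemperateGrowth {χ : E → ℂ} {R : ℝ} (h : IsCutoff χ R) :
    χ.HasTemperateGrowth :=
  h.hasCompactSupport.hasTemperateGrowth h.contDiff

omit [MeasurableSpace E] [BorelSpace E] in
theorem exists_isCutoff {R : ℝ} (hR : 0 < R) : ∃ χ : E → ℂ, IsCutoff χ R := by
  let b : ContDiffBump (0 : E) := ⟨R, 2 * R, hR, by linarith⟩
  refine ⟨fun ξ => ((b ξ : ℝ) : ℂ), ?_, ?_, fun ξ => ?_, fun ξ => ?_, fun ξ hξ => ?_, fun ξ hξ => ?_⟩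
  · exact b.hasCompactSupport.comp_left (g := fun x : ℝ => (x : ℂ)) Complex.ofReal_zero
  · exact Complex.ofRealCLM.contDiff.comp b.contDiff
  · simpa [abs_of_nonneg b.nonneg] using b.le_one
  · have h1 : (1 : ℂ) - ((b ξ : ℝ) : ℂ) = ((1 - b ξ : ℝ) : ℂ) := by push_cast; rfl
    rw [h1, Complex.norm_real, Real.norm_of_nonneg (sub_nonneg.2 b.le_one)]
    linarith [b.nonneg' ξ]
  · rw [b.one_of_mem_closedBall (by simpa using hξ)]; simp
  · rw [b.zero_of_le_dist (by simpa using hξ)]; simp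

/-- The Fourier multiplier with symbol `χ`. -/
noncomputable def multiplier (χ : E → ℂ) (f : 𝓢(E, ℂ)) : 𝓢(E, ℂ) :=
  𝓕⁻ (SchwartzMap.smulLeftCLM ℂ χ (𝓕 f))

theorem multiplier_sub (χ : E → ℂ) (f g : 𝓢(E, ℂ)) :
    multiplier χ (f - g) = multiplier χ f - multiplier χ g := by
  unfold multiplier
  rw [fourier_schwartz_sub, map_sub]
  exact map_sub (FourierTransform.fourierCLE ℂ 𝓢(E, ℂ)).symm _ _

theorem multiplier_apply {χ : E → ℂ} (hχ : χ.HasTemperateGrowth) (f : 𝓢(E, ℂ)) (x : E) :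
    multiplier χ f x = ∫ ξ, 𝐞 (inner ℝ ξ x) • (χ ξ * 𝓕 f ξ) := by
  unfold multiplier
  rw [SchwartzMap.fourierInv_coe, Real.fourierInv_eq, SchwartzMap.smulLeftCLM_apply hχ]
  rfl

theorem fourier_sub_multiplier {χ : E → ℂ} (hχ : χ.HasTemperateGrowth) (f : 𝓢(E, ℂ)) (ξ : E) :
    𝓕 (f - multiplier χ f) ξ = (1 - χ ξ) * 𝓕 f ξ := by
  have : 𝓕 (f - multiplier χ f) = 𝓕 f - SchwartzMap.smulLeftCLM ℂ χ (𝓕 f) := by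
    rw [fourier_schwartz_sub]
    unfold multiplier
    rw [FourierTransform.fourier_fourierInv_eq]
  rw [this, sub_apply, SchwartzMap.smulLeftCLM_apply_apply hχ, smul_eq_mul]
  ring

theorem integral_norm_sq_sub_multiplier_le {s : ℝ} (hs0 : 0 ≤ s) (hs1 : s ≤ 1) {χ : E → ℂ} {R : ℝ}
    (hR : 0 < R) (hχ : IsCutoff χ R) (f : 𝓢(E, ℂ)) :
    ∫ x, ‖(f - multiplier χ f) x‖ ^ 2 ≤ R ^ (-(2 * s)) * energy s f := by
  rw [← SchwartzMap.integral_norm_sq_fourier, energy, ← integral_const_mul]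
  refine integral_mono
    (by simpa using integrable_weight_mul_norm_sq (s := 0) zero_le_one (𝓕 (f - multiplier χ f)))
    ((integrable_weight_mul_norm_sq hs1 _).const_mul _) fun ξ => ?_
  dsimp only
  rw [fourier_sub_multiplier hχ.hasTemperateGrowth, norm_mul, mul_pow, ← mul_assoc]
  gcongr
  rcases le_or_gt ‖ξ‖ R with h | h
  · rw [hχ.eq_one ξ h]; simp; positivity
  · have h1 : ‖1 - χ ξ‖ ^ 2 ≤ 1 := pow_le_one₀ (norm_nonneg _) (hχ.norm_one_sub_le_one ξ)
    have h2 : R ^ (2 * s) ≤ (1 + ‖ξ‖ ^ 2) ^ s := by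
      rw [Real.rpow_mul hR.le, Real.rpow_two]
      gcongr
      nlinarith
    calc _ ≤ 1 := h1
      _ = R ^ (-(2 * s)) * R ^ (2 * s) := by
        rw [← Real.rpow_add hR]; simp
      _ ≤ _ := by gcongr

theorem integrableOn_ball_norm_rpow {α : ℝ} (hd : 1 ≤ Module.finrank ℝ E)
    (hα : α < Module.finrank ℝ E) (r : ℝ) :
    IntegrableOn (fun ξ : E => ‖ξ‖ ^ (-α)) (Metric.ball 0 r) := by
  refine integrableOn_ball_of_norm_le_rpow hd hα (C := 1) (ae_of_all _ fun ξ => ?_) ?_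
  · rw [Real.norm_of_nonneg (by positivity), one_mul]
  · exact (measurable_norm.pow_const _).aestronglyMeasurable

theorem setIntegral_ball_norm_rpow (α : ℝ) {r : ℝ} (hr : 0 < r) :
    ∫ ξ in Metric.ball (0 : E) r, ‖ξ‖ ^ (-α) =
      r ^ ((Module.finrank ℝ E : ℝ) - α) * ∫ ξ in Metric.ball (0 : E) 1, ‖ξ‖ ^ (-α) := by
  have h := Measure.setIntegral_comp_smul_of_pos (volume : Measure E) (fun ξ => ‖ξ‖ ^ (-α))
    (Metric.ball 0 1) hr
  rw [smul_unitBall_of_pos hr] at h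
  simp_rw [norm_smul, Real.norm_of_nonneg hr.le] at h
  simp_rw [Real.mul_rpow hr.le (norm_nonneg _), integral_const_mul, smul_eq_mul] at h
  rw [Real.rpow_sub hr, Real.rpow_natCast]
  rw [Real.rpow_neg hr.le] at h
  field_simp at h ⊢
  linarith

theorem norm_multiplier_apply_le {s : ℝ} (hs0 : 0 ≤ s) (hs1 : s ≤ 1)
    (hd : 1 ≤ Module.finrank ℝ E) (hns : 2 * s < Module.finrank ℝ E) {χ : E → ℂ} {R : ℝ}
    (hR : 0 < R) (hχ : IsCutoff χ R) (f : 𝓢(E, ℂ)) (x : E) :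
    ‖multiplier χ f x‖ ≤ ((∫ ξ in Metric.ball (0 : E) 1, ‖ξ‖ ^ (-(2 * s))) *
      2 ^ ((Module.finrank ℝ E : ℝ) - 2 * s) + energy s f) *
        R ^ (((Module.finrank ℝ E : ℝ) - 2 * s) / 2) := by
  have : Nontrivial E := Module.nontrivial_of_finrank_pos (R := ℝ) (by omega)
  set d : ℝ := (Module.finrank ℝ E : ℝ) - 2 * s with hdd
  set T : ℝ := R ^ (d / 2) with hT
  have hT0 : 0 < T := by positivity
  have hTT : T * T = R ^ d := by rw [hT, ← Real.rpow_add hR]; ring_nf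
  have hint1 := (integrableOn_ball_norm_rpow (E := E) hd hns (2 * R)).const_mul T⁻¹
  have hint2 := (integrable_weight_mul_norm_sq hs1 (𝓕 f)).const_mul T
  rw [multiplier_apply hχ.hasTemperateGrowth]
  refine (norm_integral_le_integral_norm _).trans ?_
  calc ∫ ξ, ‖𝐞 (inner ℝ ξ x) • (χ ξ * 𝓕 f ξ)‖
      ≤ ∫ ξ, ((Metric.ball (0 : E) (2 * R)).indicator (fun ξ => T⁻¹ * ‖ξ‖ ^ (-(2 * s))) ξ +
          T * ((1 + ‖ξ‖ ^ 2) ^ s * ‖𝓕 f ξ‖ ^ 2)) := by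
        refine integral_mono_of_nonneg (ae_of_all _ fun ξ => norm_nonneg _)
          (((integrable_indicator_iff measurableSet_ball).2 hint1).add hint2) ?_
        filter_upwards [Measure.ae_ne volume (0 : E)] with ξ hξ
        have hξ' : 0 < ‖ξ‖ := norm_pos_iff.2 hξ
        rw [Circle.norm_smul, norm_mul]
        by_cases hb : ξ ∈ Metric.ball (0 : E) (2 * R)
        · rw [Set.indicator_of_mem hb]
          have h1 : ‖χ ξ‖ * ‖𝓕 f ξ‖ ≤ ‖𝓕 f ξ‖ :=
            mul_le_of_le_one_left (norm_nonneg _) (hχ.norm_le_one ξ)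
          have h2 : ‖ξ‖ ^ (2 * s) ≤ (1 + ‖ξ‖ ^ 2) ^ s := by
            rw [Real.rpow_mul hξ'.le, Real.rpow_two]
            gcongr
            linarith
          have h3 : ‖ξ‖ ^ (2 * s) * ‖𝓕 f ξ‖ ^ 2 ≤ (1 + ‖ξ‖ ^ 2) ^ s * ‖𝓕 f ξ‖ ^ 2 := by gcongr
          have h4 : ‖𝓕 f ξ‖ ≤ T⁻¹ * ‖ξ‖ ^ (-(2 * s)) + T * (‖ξ‖ ^ (2 * s) * ‖𝓕 f ξ‖ ^ 2) := by
            rw [Real.rpow_neg hξ'.le]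
            have hp : 0 < T * ‖ξ‖ ^ (2 * s) := by positivity
            have : T⁻¹ * (‖ξ‖ ^ (2 * s))⁻¹ = (T * ‖ξ‖ ^ (2 * s))⁻¹ := by rw [mul_inv]
            rw [this, ← mul_assoc]
            set p := T * ‖ξ‖ ^ (2 * s)
            have h5 : 2 * ‖𝓕 f ξ‖ ≤ p⁻¹ + p * ‖𝓕 f ξ‖ ^ 2 := by
              have : p⁻¹ + p * ‖𝓕 f ξ‖ ^ 2 - 2 * ‖𝓕 f ξ‖ = p⁻¹ * (1 - p * ‖𝓕 f ξ‖) ^ 2 := by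
                field_simp; ring
              have : 0 ≤ p⁻¹ * (1 - p * ‖𝓕 f ξ‖) ^ 2 := by positivity
              linarith
            linarith [norm_nonneg (𝓕 f ξ)]
          have h5 := mul_le_mul_of_nonneg_left h3 hT0.le
          linarith
        · rw [Set.indicator_of_notMem hb, hχ.eq_zero ξ (by simpa using hb)]
          simp only [norm_zero, zero_mul, zero_add]
          positivity
    _ = T⁻¹ * (∫ ξ in Metric.ball (0 : E) (2 * R), ‖ξ‖ ^ (-(2 * s))) + T * energy s f := by
        rw [integral_add ((integrable_indicator_iff measurableSet_ball).2 hint1) hint2,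
          integral_indicator measurableSet_ball, integral_const_mul, integral_const_mul, energy]
    _ = _ := by
        rw [setIntegral_ball_norm_rpow (r := 2 * R) _ (by positivity), ← hdd, Real.mul_rpow two_pos.le hR.le,
          ← hTT]
        field_simp

theorem exists_volume_norm_gt_le {s : ℝ} (hs0 : 0 ≤ s) (hs1 : s ≤ 1)
    (hd : 1 ≤ Module.finrank ℝ E) (hns : 2 * s < Module.finrank ℝ E) {M : ℝ} (hM : 0 ≤ M) :
    ∃ D : ℝ, ∀ f : 𝓢(E, ℂ), energy s f ≤ M → ∀ t : ℝ, 0 < t →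
      volume {x | t < ‖f x‖} ≤ ENNReal.ofReal
        (D * t ^ (-(2 * Module.finrank ℝ E / ((Module.finrank ℝ E : ℝ) - 2 * s)))) := by
  set d : ℝ := (Module.finrank ℝ E : ℝ) - 2 * s with hdd
  have hd0 : 0 < d := by linarith
  set B : ℝ := (∫ ξ in Metric.ball (0 : E) 1, ‖ξ‖ ^ (-(2 * s))) * 2 ^ d + M + 1 with hB
  have hc : 0 ≤ ∫ ξ in Metric.ball (0 : E) 1, ‖ξ‖ ^ (-(2 * s)) :=
    integral_nonneg fun ξ => by positivity
  have hB0 : 0 < B := by positivity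
  refine ⟨4 * M * (2 * B) ^ (4 * s / d), fun f hf t ht => ?_⟩
  set R : ℝ := (t / (2 * B)) ^ (2 / d) with hR
  have hR0 : 0 < R := by positivity
  have hRd : R ^ (d / 2) = t / (2 * B) := by
    rw [hR, ← Real.rpow_mul (by positivity)]
    rw [show 2 / d * (d / 2) = 1 by field_simp, Real.rpow_one]
  obtain ⟨χ, hχ⟩ := exists_isCutoff (E := E) hR0
  set h := f - multiplier χ f with hh
  have hlow : ∀ x, ‖multiplier χ f x‖ ≤ t / 2 := fun x => by
    refine (norm_multiplier_apply_le hs0 hs1 hd hns hR0 hχ f x).trans ?_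
    rw [← hdd, hRd]
    calc _ ≤ B * (t / (2 * B)) := by gcongr; linarith
      _ = t / 2 := by field_simp
  have hsub : {x | t < ‖f x‖} ⊆ {x | (t / 2) ^ 2 ≤ ‖h x‖ ^ 2} := fun x hx => by
    have h1 : ‖f x‖ ≤ ‖multiplier χ f x‖ + ‖h x‖ := by
      have : f x = multiplier χ f x + h x := by rw [hh, sub_apply]; ring
      rw [this]
      exact norm_add_le _ _
    have h2 : t < ‖f x‖ := hx
    have h3 : t / 2 ≤ ‖h x‖ := by linarith [hlow x]
    exact pow_le_pow_left₀ (by positivity) h3 2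
  have hint : Integrable (fun x => ‖h x‖ ^ 2) := by
    simpa using integrable_weight_mul_norm_sq (s := 0) zero_le_one h
  have hfin := hint.measure_ge_lt_top (ε := (t / 2) ^ 2) (by positivity)
  refine (measure_mono hsub).trans ?_
  rw [← ENNReal.ofReal_toReal hfin.ne]
  refine ENNReal.ofReal_le_ofReal ?_
  have hch := mul_meas_ge_le_integral_of_nonneg (ae_of_all volume fun x => sq_nonneg ‖h x‖) hint
    ((t / 2) ^ 2)
  have hen := integral_norm_sq_sub_multiplier_le hs0 hs1 hR0 hχ f
  have hen' : R ^ (-(2 * s)) * energy s f ≤ R ^ (-(2 * s)) * M := by gcongr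
  have hRs : R ^ (-(2 * s)) = (2 * B) ^ (4 * s / d) * t ^ (-(4 * s / d)) := by
    rw [hR, ← Real.rpow_mul (by positivity), Real.div_rpow ht.le (by positivity),
      Real.rpow_neg ht.le, show 2 / d * -(2 * s) = -(4 * s / d) by ring,
      Real.rpow_neg (x := 2 * B) (by positivity), Real.rpow_neg ht.le]
    field_simp
  have hexp : -(2 * (Module.finrank ℝ E : ℝ) / d) = -(4 * s / d) + (-(2 : ℕ) : ℝ) := by
    have : (Module.finrank ℝ E : ℝ) = d + 2 * s := by rw [hdd]; ring
    rw [this]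
    field_simp
    push_cast
    ring
  rw [hexp, Real.rpow_add ht, Real.rpow_neg ht.le (2 : ℕ), Real.rpow_natCast]
  have h4 := (hch.trans (hen.trans hen'))
  rw [hRs] at h4
  simp only [Measure.real] at h4
  have h5 : 0 < t ^ 2 := by positivity
  have h6 : (volume {x | (t / 2) ^ 2 ≤ ‖h x‖ ^ 2}).toReal ≤
      (2 * B) ^ (4 * s / d) * t ^ (-(4 * s / d)) * M / (t / 2) ^ 2 := by
    rw [le_div_iff₀ (by positivity)]
    linarith
  refine h6.trans_eq ?_
  field_simp
  norm_num

theorem exists_lintegral_rpow_le {s : ℝ} (hs0 : 0 ≤ s) (hs1 : s ≤ 1)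
    (hd : 1 ≤ Module.finrank ℝ E) (hns : 2 * s < Module.finrank ℝ E) {M : ℝ} (hM : 0 ≤ M)
    (ν : Measure E) [IsFiniteMeasure ν] (hν : ν ≤ volume) {p : ℝ} (hp0 : 0 < p)
    (hp : p < 2 * Module.finrank ℝ E / ((Module.finrank ℝ E : ℝ) - 2 * s)) :
    ∃ C : ℝ≥0∞, C ≠ ⊤ ∧ ∀ f : 𝓢(E, ℂ), energy s f ≤ M → ∫⁻ x, ‖f x‖ₑ ^ p ∂ν ≤ C := by
  obtain ⟨D, hD⟩ := exists_volume_norm_gt_le hs0 hs1 hd hns hM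
  set P : ℝ := 2 * Module.finrank ℝ E / ((Module.finrank ℝ E : ℝ) - 2 * s)
  refine ⟨ENNReal.ofReal p * (ν Set.univ * (∫⁻ t in Set.Ioc (0 : ℝ) 1, ENNReal.ofReal (t ^ (p - 1))) +
    ∫⁻ t in Set.Ioi (1 : ℝ), ENNReal.ofReal (D * t ^ (-P + (p - 1)))), ?_, fun f hf => ?_⟩
  · have h1 : IntegrableOn (fun t : ℝ => t ^ (p - 1)) (Set.Ioc 0 1) :=
      (intervalIntegrable_iff_integrableOn_Ioc_of_le zero_le_one).1
        (intervalIntegral.intervalIntegrable_rpow' (by linarith))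
    have h2 : IntegrableOn (fun t : ℝ => D * t ^ (-P + (p - 1))) (Set.Ioi 1) :=
      (integrableOn_Ioi_rpow_of_lt (by linarith) one_pos).const_mul D
    exact ENNReal.mul_ne_top ENNReal.ofReal_ne_top (ENNReal.add_ne_top.2
      ⟨ENNReal.mul_ne_top (measure_ne_top _ _) h1.lintegral_lt_top.ne, h2.lintegral_lt_top.ne⟩)
  · have h0 : ∫⁻ x, ‖f x‖ₑ ^ p ∂ν = ∫⁻ x, ENNReal.ofReal (‖f x‖ ^ p) ∂ν := by
      refine lintegral_congr fun x => ?_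
      rw [← ofReal_norm, ENNReal.ofReal_rpow_of_nonneg (norm_nonneg _) hp0.le]
    rw [h0, lintegral_rpow_eq_lintegral_meas_lt_mul ν (ae_of_all _ fun x => norm_nonneg (f x))
      f.continuous.norm.measurable.aemeasurable hp0, ← Set.Ioc_union_Ioi_eq_Ioi zero_le_one]
    gcongr
    refine (lintegral_union_le _ _ _).trans (add_le_add ?_ ?_)
    · rw [← lintegral_const_mul' _ _ (measure_ne_top _ _)]
      gcongr
      exact Set.subset_univ _
    · refine setLIntegral_mono' measurableSet_Ioi fun t ht => ?_
      have ht0 : (0 : ℝ) < t := zero_lt_one.trans ht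
      rw [Real.rpow_add ht0, ← mul_assoc, ENNReal.ofReal_mul' (by positivity)]
      gcongr
      exact (hν _).trans (hD f hf t ht0)

theorem exists_subseq_tendsto_inner {𝕜 H : Type*} [RCLike 𝕜] [NormedAddCommGroup H]
    [InnerProductSpace 𝕜 H] [TopologicalSpace.SeparableSpace H] {u : ℕ → H} {C : ℝ}
    (hu : ∀ k, ‖u k‖ ≤ C) :
    ∃ φ : ℕ → ℕ, StrictMono φ ∧
      ∀ v : H, ∃ l : 𝕜, Tendsto (fun j => inner 𝕜 v (u (φ j))) atTop (𝓝 l) := by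
  obtain ⟨a, -, φ, hφ, ha⟩ := WeakDual.isSeqCompact_closedBall (𝕜 := 𝕜) H 0 C
    (x := fun k => StrongDual.toWeakDual (innerSL 𝕜 (u k))) (fun k => by
      simpa using hu k)
  refine ⟨φ, hφ, fun v => ⟨star (a v), ?_⟩⟩
  have h1 : Tendsto (fun j => inner 𝕜 (u (φ j)) v) atTop (𝓝 (a v)) :=
    ((WeakDual.eval_continuous v).tendsto a).comp ha
  refine h1.star.congr fun j => ?_
  exact inner_conj_symm v (u (φ j))

theorem exists_subseq_tendsto_multiplier {f : ℕ → 𝓢(E, ℂ)} {M : ℝ}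
    (hf : ∀ k, ∫ ξ, ‖𝓕 (f k) ξ‖ ^ 2 ≤ M) :
    ∃ φ : ℕ → ℕ, StrictMono φ ∧ ∀ (χ : E → ℂ), HasCompactSupport χ → ContDiff ℝ ∞ χ → ∀ x,
      ∃ l : ℂ, Tendsto (fun j => multiplier χ (f (φ j)) x) atTop (𝓝 l) := by
  have : Fact ((2 : ℝ≥0∞) ≠ ⊤) := ⟨by simp⟩
  have hb : ∀ k, ‖(𝓕 (f k)).toLp 2‖ ≤ √M := fun k => by
    rw [SchwartzMap.norm_toLp' (by simp) (by simp)]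
    simpa [Real.sqrt_eq_rpow] using Real.sqrt_le_sqrt (hf k)
  obtain ⟨φ, hφ, h⟩ := exists_subseq_tendsto_inner (𝕜 := ℂ) hb
  refine ⟨φ, hφ, fun χ hχ hχ' x => ?_⟩
  have hχL : MemLp χ 2 := hχ'.continuous.memLp_of_hasCompactSupport hχ
  have hv : MemLp (fun ξ => star (𝐞 (inner ℝ ξ x) • χ ξ)) 2 := by
    refine hχL.of_le ?_ (ae_of_all _ fun ξ => ?_)
    · refine Continuous.aestronglyMeasurable ?_
      have := hχ'.continuous
      have := Real.continuous_fourierChar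
      fun_prop
    · rw [norm_star, Circle.norm_smul]
  obtain ⟨l, hl⟩ := h hv.toLp
  refine ⟨l, hl.congr fun j => ?_⟩
  rw [multiplier_apply (hχ.hasTemperateGrowth hχ'), L2.inner_def]
  refine integral_congr_ae ?_
  filter_upwards [hv.coeFn_toLp, (𝓕 (f (φ j))).coeFn_toLp 2] with ξ h1 h2
  rw [h1, h2, RCLike.inner_apply, Circle.smul_def, Circle.smul_def]
  simp
  ring

theorem enorm_rpow_eq_ofReal (z : ℂ) {p : ℝ} (hp : 0 ≤ p) :
    ‖z‖ₑ ^ p = ENNReal.ofReal (‖z‖ ^ p) := by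
  rw [← ofReal_norm, ENNReal.ofReal_rpow_of_nonneg (norm_nonneg _) hp]

theorem tendsto_lintegral_multiplier_sub {s : ℝ} (hs0 : 0 ≤ s) (hs1 : s ≤ 1)
    (hd : 1 ≤ Module.finrank ℝ E) (hns : 2 * s < Module.finrank ℝ E) {M : ℝ}
    (ν : Measure E) [IsFiniteMeasure ν] {f : ℕ → 𝓢(E, ℂ)} (hf : ∀ k, energy s (f k) ≤ M)
    {χ : E → ℂ} {R : ℝ} (hR : 0 < R) (hχ : IsCutoff χ R)
    (hconv : ∀ x, ∃ l : ℂ, Tendsto (fun j => multiplier χ (f j) x) atTop (𝓝 l)) :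
    Tendsto (fun p : ℕ × ℕ => ∫⁻ x, ‖multiplier χ (f p.1) x - multiplier χ (f p.2) x‖ₑ ^ (2 : ℝ) ∂ν)
      atTop (𝓝 0) := by
  set K : ℝ := ((∫ ξ in Metric.ball (0 : E) 1, ‖ξ‖ ^ (-(2 * s))) *
      2 ^ ((Module.finrank ℝ E : ℝ) - 2 * s) + M) * R ^ (((Module.finrank ℝ E : ℝ) - 2 * s) / 2)
  have hK : ∀ k x, ‖multiplier χ (f k) x‖ ≤ K := fun k x => by
    refine (norm_multiplier_apply_le hs0 hs1 hd hns hR hχ (f k) x).trans ?_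
    dsimp only [K]
    gcongr
    exact hf k
  have h0 : (0 : ℝ≥0∞) = ∫⁻ x : E, 0 ∂ν := by simp
  rw [h0]
  refine tendsto_lintegral_filter_of_dominated_convergence
    (fun _ => ENNReal.ofReal ((K + K) ^ (2 : ℝ))) ?_ ?_ ?_ ?_
  · refine Eventually.of_forall fun p => ?_
    have h1 := (multiplier χ (f p.1)).continuous
    have h2 := (multiplier χ (f p.2)).continuous
    exact (h1.sub h2).enorm.measurable.pow_const _
  · refine Eventually.of_forall fun p => ae_of_all _ fun x => ?_
    rw [enorm_rpow_eq_ofReal _ two_pos.le]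
    gcongr
    exact (norm_sub_le _ _).trans (add_le_add (hK _ x) (hK _ x))
  · simpa using ENNReal.mul_ne_top ENNReal.ofReal_ne_top (measure_ne_top _ _)
  · refine ae_of_all _ fun x => ?_
    obtain ⟨l, hl⟩ := hconv x
    have h1 : Tendsto (fun p : ℕ × ℕ => multiplier χ (f p.1) x - multiplier χ (f p.2) x) atTop
        (𝓝 0) := by
      rw [← prod_atTop_atTop_eq, ← sub_self l]
      exact (hl.comp tendsto_fst).sub (hl.comp tendsto_snd)
    have h2 := (ENNReal.continuous_rpow_const (y := 2)).tendsto (‖(0 : ℂ)‖ₑ)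
    simpa [Function.comp_def] using h2.comp h1.enorm

theorem tendsto_lintegral_sub_sq {s : ℝ} (hs0 : 0 < s) (hs1 : s ≤ 1)
    (hd : 1 ≤ Module.finrank ℝ E) (hns : 2 * s < Module.finrank ℝ E) {M : ℝ}
    (ν : Measure E) [IsFiniteMeasure ν] (hν : ν ≤ volume) {f : ℕ → 𝓢(E, ℂ)}
    (hf : ∀ k, energy s (f k) ≤ M)
    (hconv : ∀ (χ : E → ℂ), HasCompactSupport χ → ContDiff ℝ ∞ χ → ∀ x,
      ∃ l : ℂ, Tendsto (fun j => multiplier χ (f j) x) atTop (𝓝 l)) :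
    Tendsto (fun p : ℕ × ℕ => ∫⁻ x, ‖(f p.1 - f p.2) x‖ₑ ^ (2 : ℝ) ∂ν) atTop (𝓝 0) := by
  rw [ENNReal.tendsto_nhds_zero]
  intro ε hε
  have hε2 : 0 < ε / 2 / 2 := by simpa [ENNReal.div_pos_iff] using hε.ne'
  have hRlim : Tendsto (fun R : ℝ => ENNReal.ofReal (R ^ (-(2 * s)) * (4 * M))) atTop (𝓝 0) := by
    have h1 := (tendsto_rpow_neg_atTop (y := 2 * s) (by linarith)).mul_const (4 * M)
    simpa [Function.comp_def] using (ENNReal.continuous_ofReal.tendsto _).comp h1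
  obtain ⟨R, hRε, hR⟩ := ((hRlim.eventually (Iic_mem_nhds hε2)).and (eventually_gt_atTop 0)).exists
  obtain ⟨χ, hχ⟩ := exists_isCutoff (E := E) hR
  have hlow := tendsto_lintegral_multiplier_sub hs0.le hs1 hd hns ν hf hR hχ
    (hconv χ hχ.hasCompactSupport hχ.contDiff)
  filter_upwards [hlow.eventually (Iic_mem_nhds hε2)] with p hp
  set h := f p.1 - f p.2 with hh
  have hhigh : ∫⁻ x, ‖(h - multiplier χ h) x‖ₑ ^ (2 : ℝ) ∂ν ≤ ε / 2 / 2 := by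
    have hint : Integrable (fun x => ‖(h - multiplier χ h) x‖ ^ 2) := by
      simpa using integrable_weight_mul_norm_sq (s := 0) zero_le_one (h - multiplier χ h)
    calc _ ≤ ∫⁻ x, ‖(h - multiplier χ h) x‖ₑ ^ (2 : ℝ) := lintegral_mono' hν le_rfl
      _ = ENNReal.ofReal (∫ x, ‖(h - multiplier χ h) x‖ ^ 2) := by
        rw [ofReal_integral_eq_lintegral_ofReal hint (ae_of_all _ fun x => sq_nonneg _)]
        refine lintegral_congr fun x => ?_
        rw [enorm_rpow_eq_ofReal _ two_pos.le, Real.rpow_two]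
      _ ≤ ENNReal.ofReal (R ^ (-(2 * s)) * (4 * M)) := by
        refine ENNReal.ofReal_le_ofReal
          ((integral_norm_sq_sub_multiplier_le hs0.le hs1 hR hχ h).trans ?_)
        gcongr
        linarith [energy_sub_le hs1 (f p.1) (f p.2), hf p.1, hf p.2]
      _ ≤ _ := hRε
  have hp' : ∫⁻ x, ‖multiplier χ h x‖ₑ ^ (2 : ℝ) ∂ν ≤ ε / 2 / 2 := by
    rw [hh, multiplier_sub]
    exact hp
  have hmeas : Measurable fun x => ‖multiplier χ h x‖ₑ ^ (2 : ℝ) :=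
    (multiplier χ h).continuous.enorm.measurable.pow_const _
  calc ∫⁻ x, ‖h x‖ₑ ^ (2 : ℝ) ∂ν
      ≤ ∫⁻ x, 2 * (‖multiplier χ h x‖ₑ ^ (2 : ℝ) + ‖(h - multiplier χ h) x‖ₑ ^ (2 : ℝ)) ∂ν := by
        refine lintegral_mono fun x => ?_
        have h1 : h x = multiplier χ h x + (h - multiplier χ h) x := by
          rw [sub_apply h]; ring
        have h2 : ‖h x‖ₑ ≤ ‖multiplier χ h x‖ₑ + ‖(h - multiplier χ h) x‖ₑ := by
          conv_lhs => rw [h1]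
          exact enorm_add_le _ _
        refine (ENNReal.rpow_le_rpow h2 two_pos.le).trans ?_
        refine (ENNReal.rpow_add_le_mul_rpow_add_rpow _ _ one_le_two).trans_eq ?_
        norm_num
    _ = 2 * (∫⁻ x, ‖multiplier χ h x‖ₑ ^ (2 : ℝ) ∂ν +
          ∫⁻ x, ‖(h - multiplier χ h) x‖ₑ ^ (2 : ℝ) ∂ν) := by
        rw [lintegral_const_mul' _ _ (by simp), lintegral_add_left hmeas]
    _ ≤ 2 * (ε / 2 / 2 + ε / 2 / 2) := by gcongr
    _ = ε := by rw [ENNReal.add_halves, ENNReal.mul_div_cancel (by simp) (by simp)]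

theorem rpow_le_add_rpow {a T p r : ℝ} (ha : 0 ≤ a) (hT : 0 < T) (hp : 2 ≤ p) (hpr : p ≤ r) :
    a ^ p ≤ T ^ (p - 2) * a ^ (2 : ℝ) + T ^ (p - r) * a ^ r := by
  rcases le_or_gt a T with h | h
  · have h1 : a ^ p = a ^ (p - 2) * a ^ (2 : ℝ) := by
      rw [← Real.rpow_add_of_nonneg ha (by linarith) two_pos.le]; ring_nf
    have h2 : a ^ (p - 2) * a ^ (2 : ℝ) ≤ T ^ (p - 2) * a ^ (2 : ℝ) := by gcongr
    have h3 : 0 ≤ T ^ (p - r) * a ^ r := by positivity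
    linarith
  · have h1 : a ^ p = a ^ (p - r) * a ^ r := by
      rw [← Real.rpow_add (hT.trans h)]; ring_nf
    have h2 : a ^ (p - r) * a ^ r ≤ T ^ (p - r) * a ^ r := by
      gcongr ?_ * _
      exact Real.rpow_le_rpow_of_nonpos hT h.le (by linarith)
    have h3 : 0 ≤ T ^ (p - 2) * a ^ (2 : ℝ) := by positivity
    linarith

theorem tendsto_lintegral_sub_rpow {s : ℝ} (hs0 : 0 < s) (hs1 : s ≤ 1)
    (hd : 1 ≤ Module.finrank ℝ E) (hns : 2 * s < Module.finrank ℝ E) {M : ℝ}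
    (ν : Measure E) [IsFiniteMeasure ν] (hν : ν ≤ volume) {f : ℕ → 𝓢(E, ℂ)}
    (hf : ∀ k, energy s (f k) ≤ M)
    (hconv : ∀ (χ : E → ℂ), HasCompactSupport χ → ContDiff ℝ ∞ χ → ∀ x,
      ∃ l : ℂ, Tendsto (fun j => multiplier χ (f j) x) atTop (𝓝 l))
    {p : ℝ} (hp2 : 2 ≤ p)
    (hp : p < 2 * Module.finrank ℝ E / ((Module.finrank ℝ E : ℝ) - 2 * s)) :
    Tendsto (fun i : ℕ × ℕ => ∫⁻ x, ‖(f i.1 - f i.2) x‖ₑ ^ p ∂ν) atTop (𝓝 0) := by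
  obtain ⟨r, hpr, hr⟩ := exists_between hp
  have hM : 0 ≤ M := (energy_nonneg s (f 0)).trans (hf 0)
  obtain ⟨C, hC, hCf⟩ := exists_lintegral_rpow_le hs0.le hs1 hd hns (M := 4 * M) (by linarith) ν hν
    (by linarith) hr
  have hL2 := tendsto_lintegral_sub_sq hs0 hs1 hd hns ν hν hf hconv
  rw [ENNReal.tendsto_nhds_zero]
  intro ε hε
  have hε2 : 0 < ε / 2 := ENNReal.half_pos hε.ne'
  have hTlim : Tendsto (fun T : ℝ => ENNReal.ofReal (T ^ (p - r)) * C) atTop (𝓝 0) := by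
    have h1 := (tendsto_rpow_neg_atTop (y := r - p) (by linarith))
    have h2 := ENNReal.Tendsto.mul_const ((ENNReal.continuous_ofReal.tendsto _).comp h1)
      (Or.inr hC)
    simpa [Function.comp_def] using h2
  obtain ⟨T, hTε, hT⟩ := ((hTlim.eventually (Iic_mem_nhds hε2)).and (eventually_gt_atTop 0)).exists
  have hL2' := ENNReal.Tendsto.const_mul hL2 (Or.inr (ENNReal.ofReal_ne_top (r := T ^ (p - 2))))
  rw [mul_zero] at hL2'
  filter_upwards [hL2'.eventually (Iic_mem_nhds hε2)] with i hi
  have hmeas : Measurable fun x => ‖(f i.1 - f i.2) x‖ₑ ^ (2 : ℝ) :=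
    (f i.1 - f i.2).continuous.enorm.measurable.pow_const _
  have hen : energy s (f i.1 - f i.2) ≤ 4 * M := by
    linarith [energy_sub_le hs1 (f i.1) (f i.2), hf i.1, hf i.2]
  calc ∫⁻ x, ‖(f i.1 - f i.2) x‖ₑ ^ p ∂ν
      ≤ ∫⁻ x, (ENNReal.ofReal (T ^ (p - 2)) * ‖(f i.1 - f i.2) x‖ₑ ^ (2 : ℝ) +
          ENNReal.ofReal (T ^ (p - r)) * ‖(f i.1 - f i.2) x‖ₑ ^ r) ∂ν := by
        refine lintegral_mono fun x => ?_
        rw [enorm_rpow_eq_ofReal _ (by linarith), enorm_rpow_eq_ofReal _ two_pos.le,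
          enorm_rpow_eq_ofReal _ (by linarith), ← ENNReal.ofReal_mul (by positivity),
          ← ENNReal.ofReal_mul (by positivity), ← ENNReal.ofReal_add (by positivity)
          (by positivity)]
        exact ENNReal.ofReal_le_ofReal (rpow_le_add_rpow (norm_nonneg _) hT hp2 hpr.le)
    _ = ENNReal.ofReal (T ^ (p - 2)) * ∫⁻ x, ‖(f i.1 - f i.2) x‖ₑ ^ (2 : ℝ) ∂ν +
          ENNReal.ofReal (T ^ (p - r)) * ∫⁻ x, ‖(f i.1 - f i.2) x‖ₑ ^ r ∂ν := by
        rw [lintegral_add_left (hmeas.const_mul _), lintegral_const_mul' _ _ ENNReal.ofReal_ne_top,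
          lintegral_const_mul' _ _ ENNReal.ofReal_ne_top]
    _ ≤ ε / 2 + ε / 2 := by
        refine add_le_add hi (le_trans ?_ hTε)
        gcongr
        exact hCf _ hen
    _ = ε := ENNReal.add_halves ε

theorem exists_isFiniteMeasure_le_volume :
    ∃ ν : Measure E, IsFiniteMeasure ν ∧ ν ≤ volume ∧
      ∀ K : Set E, IsCompact K → ∃ c : ℝ≥0∞, c ≠ ⊤ ∧ volume.restrict K ≤ c • ν := by
  set r : ℝ := (Module.finrank ℝ E : ℝ) + 1 with hr
  have hr0 : 0 ≤ r := by positivity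
  set w : E → ℝ≥0∞ := fun x => ENNReal.ofReal ((1 + ‖x‖) ^ (-r)) with hw
  refine ⟨volume.withDensity w, ?_, ?_, fun K hK => ?_⟩
  · refine isFiniteMeasure_withDensity ?_
    exact (finite_integral_one_add_norm (μ := (volume : Measure E)) (by linarith)).ne
  · refine Measure.le_iff.2 fun A hA => ?_
    rw [withDensity_apply _ hA]
    calc ∫⁻ x in A, w x ≤ ∫⁻ x in A, 1 := by
          refine lintegral_mono fun x => ?_
          rw [hw, ENNReal.ofReal_le_one]
          exact Real.rpow_le_one_of_one_le_of_nonpos (by linarith [norm_nonneg x]) (by linarith)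
      _ = volume A := by simp
  · obtain ⟨ρ, hρ⟩ := hK.isBounded.exists_norm_le
    refine ⟨ENNReal.ofReal ((1 + ρ) ^ r), ENNReal.ofReal_ne_top, Measure.le_iff.2 fun A hA => ?_⟩
    have hAK : MeasurableSet (A ∩ K) := hA.inter hK.measurableSet
    rw [Measure.restrict_apply hA, Measure.smul_apply, smul_eq_mul]
    calc volume (A ∩ K) = ∫⁻ x in A ∩ K, 1 := by simp
      _ ≤ ∫⁻ x in A ∩ K, ENNReal.ofReal ((1 + ρ) ^ r) * w x := by
        refine setLIntegral_mono' hAK fun x hx => ?_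
        have h1 : 0 < 1 + ‖x‖ := by positivity
        have h2 : ‖x‖ ≤ ρ := hρ x hx.2
        have h3 : (1 + ‖x‖) ^ r ≤ (1 + ρ) ^ r := by gcongr
        have h4 : 0 ≤ 1 + ρ := by linarith
        rw [hw, ← ENNReal.ofReal_mul (Real.rpow_nonneg h4 r), ENNReal.one_le_ofReal, Real.rpow_neg h1.le,
          ← div_eq_mul_inv, one_le_div (by positivity)]
        exact h3
      _ = ENNReal.ofReal ((1 + ρ) ^ r) * volume.withDensity w (A ∩ K) := by
        rw [lintegral_const_mul' _ _ ENNReal.ofReal_ne_top, withDensity_apply _ hAK]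
      _ ≤ _ := by gcongr; exact Set.inter_subset_left

theorem eLpNorm_ofReal_eq {α : Type*} [MeasurableSpace α] (μ : Measure α) (u : α → ℂ) {p : ℝ}
    (hp : 0 < p) :
    eLpNorm u (ENNReal.ofReal p) μ = (∫⁻ x, ‖u x‖ₑ ^ p ∂μ) ^ (1 / p) := by
  rw [eLpNorm_eq_lintegral_rpow_enorm_toReal (by simpa using hp) ENNReal.ofReal_ne_top,
    ENNReal.toReal_ofReal hp.le]

theorem tendsto_integral_norm_rpow_of_tendsto_eLpNorm {α : Type*} [MeasurableSpace α]
    {μ : Measure α} {u : ℕ → α → ℂ} {q : ℝ} (hq : 0 < q)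
    (hu : ∀ j, AEStronglyMeasurable (u j) μ)
    (h : Tendsto (fun j => eLpNorm (u j) (ENNReal.ofReal q) μ) atTop (𝓝 0)) :
    Tendsto (fun j => ∫ x, ‖u j x‖ ^ q ∂μ) atTop (𝓝 0) := by
  have h1 : ∀ j, ∫ x, ‖u j x‖ ^ q ∂μ = (eLpNorm (u j) (ENNReal.ofReal q) μ ^ q).toReal := by
    intro j
    rw [integral_eq_lintegral_of_nonneg_ae (ae_of_all _ fun x => by positivity)
      ((hu j).norm.aemeasurable.pow_const q).aestronglyMeasurable, eLpNorm_ofReal_eq μ _ hq,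
      ← ENNReal.rpow_mul, one_div, inv_mul_cancel₀ hq.ne', ENNReal.rpow_one]
    simp_rw [enorm_rpow_eq_ofReal _ hq.le]
  simp_rw [h1]
  have h2 := ((ENNReal.continuous_rpow_const (y := q)).tendsto _).comp h
  rw [ENNReal.zero_rpow_of_pos hq] at h2
  simpa [Function.comp_def] using (ENNReal.tendsto_toReal ENNReal.zero_ne_top).comp h2

theorem exists_tendsto_eLpNorm_sub {α : Type*} [MeasurableSpace α] {μ : Measure α}
    {u : ℕ → α → ℂ} {p : ℝ} (hp : 1 ≤ p) (hu : ∀ j, MemLp (u j) (ENNReal.ofReal p) μ)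
    (h : Tendsto (fun i : ℕ × ℕ => ∫⁻ x, ‖u i.1 x - u i.2 x‖ₑ ^ p ∂μ) atTop (𝓝 0)) :
    ∃ g : α → ℂ, MemLp g (ENNReal.ofReal p) μ ∧
      Tendsto (fun j => eLpNorm (u j - g) (ENNReal.ofReal p) μ) atTop (𝓝 0) := by
  have hp0 : 0 < p := zero_lt_one.trans_le hp
  have : Fact (1 ≤ ENNReal.ofReal p) := ⟨by simpa using hp⟩
  have hc : CauchySeq fun j => (hu j).toLp := by
    rw [cauchySeq_iff_tendsto_dist_atTop_0]
    have h1 := ((ENNReal.continuous_rpow_const (y := 1 / p)).tendsto _).comp h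
    rw [ENNReal.zero_rpow_of_pos (by positivity)] at h1
    refine ((ENNReal.tendsto_toReal ENNReal.zero_ne_top).comp h1).congr fun i => ?_
    rw [dist_edist, Lp.edist_toLp_toLp, eLpNorm_ofReal_eq μ _ hp0]
    rfl
  obtain ⟨g, hg⟩ := cauchySeq_tendsto_of_complete hc
  refine ⟨g, Lp.memLp g, ?_⟩
  have h1 := (tendsto_iff_edist_tendsto_0).1 hg
  refine h1.congr fun j => ?_
  rw [Lp.edist_def]
  exact eLpNorm_congr_ae ((hu j).coeFn_toLp.sub (ae_eq_refl _))

/-- A family of Schwartz functions which is bounded in `H^s` has a subsequence converging in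
`L^q` on every compact set, for every subcritical exponent `q`. -/
theorem exists_subseq_tendsto_eLpNorm {s : ℝ} (hs0 : 0 < s) (hs1 : s ≤ 1)
    (hd : 1 ≤ Module.finrank ℝ E) (hns : 2 * s < Module.finrank ℝ E) {M : ℝ}
    {f : ℕ → 𝓢(E, ℂ)} (hf : ∀ k, energy s (f k) ≤ M) {q : ℝ} (hq1 : 1 ≤ q)
    (hq : q < 2 * Module.finrank ℝ E / ((Module.finrank ℝ E : ℝ) - 2 * s)) :
    ∃ φ : ℕ → ℕ, StrictMono φ ∧ ∃ g : E → ℂ, ∀ K : Set E, IsCompact K →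
      MemLp g (ENNReal.ofReal q) (volume.restrict K) ∧
      Tendsto (fun j => eLpNorm (⇑(f (φ j)) - g) (ENNReal.ofReal q) (volume.restrict K))
        atTop (𝓝 0) := by
  obtain ⟨ν, hνfin, hν, hνK⟩ := exists_isFiniteMeasure_le_volume (E := E)
  obtain ⟨φ, hφ, hconv⟩ := exists_subseq_tendsto_multiplier
    fun k => (integral_norm_sq_fourier_le_energy hs0.le hs1 (f k)).trans (hf k)
  have hp : max q 2 < 2 * Module.finrank ℝ E / ((Module.finrank ℝ E : ℝ) - 2 * s) := by
    refine max_lt hq ?_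
    rw [lt_div_iff₀ (by linarith)]
    linarith
  obtain ⟨g, hg, hlim⟩ := exists_tendsto_eLpNorm_sub (u := fun j => ⇑(f (φ j)))
    (hq1.trans (le_max_left q 2))
    (fun j => ((f (φ j)).memLp _ volume).mono_measure hν)
    (tendsto_lintegral_sub_rpow hs0 hs1 hd hns ν hν (f := fun j => f (φ j)) (fun k => hf (φ k))
      hconv (le_max_right q 2) hp)
  have hqp : ENNReal.ofReal q ≤ ENNReal.ofReal (max q 2) :=
    ENNReal.ofReal_le_ofReal (le_max_left _ _)
  have hgq : MemLp g (ENNReal.ofReal q) ν := hg.mono_exponent hqp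
  refine ⟨φ, hφ, g, fun K hK => ?_⟩
  obtain ⟨c, hc, hcK⟩ := hνK K hK
  refine ⟨hgq.of_measure_le_smul hc hcK, ?_⟩
  set e : ℝ := 1 / (ENNReal.ofReal q).toReal - 1 / (ENNReal.ofReal (max q 2)).toReal with he
  have he0 : 0 ≤ e := by
    rw [he, ENNReal.toReal_ofReal (by linarith), ENNReal.toReal_ofReal (by positivity), sub_nonneg]
    exact one_div_le_one_div_of_le (by linarith) (le_max_left _ _)
  have hbound : ∀ j, eLpNorm (⇑(f (φ j)) - g) (ENNReal.ofReal q) (volume.restrict K) ≤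
      c ^ (1 / ENNReal.ofReal q).toReal *
        (eLpNorm (⇑(f (φ j)) - g) (ENNReal.ofReal (max q 2)) ν * ν Set.univ ^ e) := fun j => by
    refine (eLpNorm_mono_measure _ hcK).trans ?_
    rw [eLpNorm_smul_measure_of_ne_top ENNReal.ofReal_ne_top, smul_eq_mul]
    gcongr
    exact eLpNorm_le_eLpNorm_mul_rpow_measure_univ hqp
      ((f (φ j)).continuous.aestronglyMeasurable.sub hg.aestronglyMeasurable)
  refine tendsto_of_tendsto_of_tendsto_of_le_of_le tendsto_const_nhds ?_ (fun _ => bot_le) hbound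
  have h1 := ENNReal.Tendsto.const_mul (a := c ^ (1 / ENNReal.ofReal q).toReal)
    (ENNReal.Tendsto.mul_const (b := ν Set.univ ^ e) hlim
      (Or.inr (ENNReal.rpow_ne_top_of_nonneg he0 (measure_ne_top ν _))))
    (Or.inr (ENNReal.rpow_ne_top_of_nonneg ENNReal.toReal_nonneg hc))
  simpa using h1

end FractionalSobolev

theorem statement17 (n : ℕ) (hn : 1 ≤ n) (s : ℝ) (hs0 : 0 < s) (hs1 : s < 1)
    (hns : 2 * s < (n : ℝ))
    (f : ℕ → SchwartzMap (EuclideanSpace ℝ (Fin n)) ℂ) (M : ℝ)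
    (hM : ∀ k, (∫ ξ : EuclideanSpace ℝ (Fin n),
      (1 + ‖ξ‖ ^ 2) ^ s * ‖𝓕 ⇑(f k) ξ‖ ^ 2) ≤ M) :
    ∀ q : ℝ, 1 ≤ q → q < 2 * n / ((n : ℝ) - 2 * s) →
      ∃ φ : ℕ → ℕ, StrictMono φ ∧
        ∃ g : EuclideanSpace ℝ (Fin n) → ℂ,
          (∀ K : Set (EuclideanSpace ℝ (Fin n)), IsCompact K →
            IntegrableOn (fun x => ‖g x‖ ^ q) K) ∧
          ∀ K : Set (EuclideanSpace ℝ (Fin n)), IsCompact K →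
            Tendsto (fun j => ∫ x in K, ‖f (φ j) x - g x‖ ^ q) atTop (nhds 0) := by
  intro q hq1 hq
  have hq0 : 0 < q := zero_lt_one.trans_le hq1
  obtain ⟨φ, hφ, g, hg⟩ := FractionalSobolev.exists_subseq_tendsto_eLpNorm
    (E := EuclideanSpace ℝ (Fin n)) hs0 hs1.le (by simpa using hn) (by simpa using hns) hM hq1
    (by simpa using hq)
  refine ⟨φ, hφ, g, fun K hK => ?_, fun K hK => ?_⟩
  · have h := (hg K hK).1.integrable_norm_rpow (by simpa using hq0) ENNReal.ofReal_ne_top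
    rwa [ENNReal.toReal_ofReal hq0.le] at h
  · exact FractionalSobolev.tendsto_integral_norm_rpow_of_tendsto_eLpNorm hq0
      (fun j => (f (φ j)).continuous.aestronglyMeasurable.sub (hg K hK).1.aestronglyMeasurable)
      (hg K hK).2
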